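/- The quotient ring R₁₈/I_{G₂} has Krull dimension 12; that is, the G₂ cluster variety X_{G₂} ⊆ ℂ¹⁸ is a 12-dimensional affine variety of codimension 6. -/

import Mathlib

/-!
The G₂ cluster variety.

`R18` is the polynomial ring over ℂ in the 18 variables, indexed as follows:
`0 ↦ θ₁, 1 ↦ θ₁₂, 2 ↦ θ₂, 3 ↦ θ₂₃, 4 ↦ θ₃, 5 ↦ θ₃₄, 6 ↦ θ₄, 7 ↦ θ₄₁,
 8 ↦ A₁, 9 ↦ A₁₂, 10 ↦ A₂, 11 ↦ A₂₃, 12 ↦ A₃, 13 ↦ A₃₄, 14 ↦ A₄, 15 ↦ A₄₁,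
 16 ↦ λ₁₃, 17 ↦ λ₂₄`.
Indices `i : Fin 4` stand for the indices 1,2,3,4 taken modulo 4, with `Fin 4` addition.
-/

open MvPolynomial

noncomputable section

abbrev R18 : Type := MvPolynomial (Fin 18) ℂ

/-- The cluster variables θ₁, θ₂, θ₃, θ₄. -/
def th : Fin 4 → R18 := ![X 0, X 2, X 4, X 6]

/-- The cluster variables θ₁₂, θ₂₃, θ₃₄, θ₄₁ : `thp i = θ_{i,i+1}`. -/
def thp : Fin 4 → R18 := ![X 1, X 3, X 5, X 7]

/-- The coefficients A₁, A₂, A₃, A₄. -/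
def aS : Fin 4 → R18 := ![X 8, X 10, X 12, X 14]

/-- The coefficients A₁₂, A₂₃, A₃₄, A₄₁ : `aP i = A_{i,i+1}`. -/
def aP : Fin 4 → R18 := ![X 9, X 11, X 13, X 15]

/-- The parameters: `lam i = λ_{i,i+2}`, so `λ₁₃ = lam 0 = lam 2` and
`λ₂₄ = lam 1 = lam 3` (unordered pairs of opposite indices). -/
def lam : Fin 4 → R18 := ![X 16, X 17, X 16, X 17]

/-- `θ_{xy}` for *adjacent* `x y : Fin 4` (unordered pair: `θ_{xy} = θ_{yx}`). -/
def thpp (x y : Fin 4) : R18 := if y = x + 1 then thp x else thp y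

/-- `A_{xy}` for *adjacent* `x y : Fin 4` (unordered pair: `A_{xy} = A_{yx}`). -/
def aPP (x y : Fin 4) : R18 := if y = x + 1 then aP x else aP y

/-- The dihedral permutation `(i,j,k,l)` of `(1,2,3,4)` starting at `s` with direction `d`:
position `t` is sent to `s + t` (if `d`) or `s - t` (otherwise). The eight choices of
`(s, d)` give the eight dihedral permutations (cyclic rotations and their reversals). -/
def dih (s : Fin 4) (d : Bool) (t : Fin 4) : Fin 4 := if d then s + t else s - t

/-- Family 1: `θᵢθⱼ − A_{ij}θ_{ij} − A_{jk}A_kA_{kl}²A_lA_{li}` (4 distinct equations). -/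
def f1 (s : Fin 4) (d : Bool) : R18 :=
  let i := dih s d 0; let j := dih s d 1; let k := dih s d 2; let l := dih s d 3
  th i * th j - aPP i j * thpp i j - aPP j k * aS k * aPP k l ^ 2 * aS l * aPP l i

/-- Family 2: `θ_{ij}θ_{jk} − A_jθⱼ³ − λ_{jl}A_{kl}A_{li}θⱼ² − λ_{ik}A_{kl}²A_lA_{li}²θⱼ
− A_kA_{kl}³A_l²A_{li}³A_i` (4 distinct equations). -/
def f2 (s : Fin 4) (d : Bool) : R18 :=
  let i := dih s d 0; let j := dih s d 1; let k := dih s d 2; let l := dih s d 3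
  thpp i j * thpp j k - aS j * th j ^ 3 - lam j * aPP k l * aPP l i * th j ^ 2
    - lam i * aPP k l ^ 2 * aS l * aPP l i ^ 2 * th j
    - aS k * aPP k l ^ 3 * aS l ^ 2 * aPP l i ^ 3 * aS i

/-- Family 3: `θᵢθ_{jk} − A_{ij}A_jθⱼ² − λ_{jl}A_{kl}A_{li}A_{ij}θⱼ − λ_{ik}A_{kl}²A_lA_{li}²A_{ij}
− A_kA_{kl}²A_lA_{li}θ_k` (8 distinct equations). -/
def f3 (s : Fin 4) (d : Bool) : R18 :=
  let i := dih s d 0; let j := dih s d 1; let k := dih s d 2; let l := dih s d 3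
  th i * thpp j k - aPP i j * aS j * th j ^ 2 - lam j * aPP k l * aPP l i * aPP i j * th j
    - lam i * aPP k l ^ 2 * aS l * aPP l i ^ 2 * aPP i j
    - aS k * aPP k l ^ 2 * aS l * aPP l i * th k

/-- Family 4: `θᵢθ_k − A_{ij}A_jA_{jk}θⱼ − λ_{jl}A_{ij}A_{jk}A_{kl}A_{li} − A_{kl}A_lA_{li}θ_l`
(2 distinct equations). -/
def f4 (s : Fin 4) (d : Bool) : R18 :=
  let i := dih s d 0; let j := dih s d 1; let k := dih s d 2; let l := dih s d 3
  th i * th k - aPP i j * aS j * aPP j k * th j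
    - lam j * aPP i j * aPP j k * aPP k l * aPP l i - aPP k l * aS l * aPP l i * th l

/-- Family 5: `θ_{ij}θ_{kl} − A_jA_{jk}²A_kθⱼθ_k − A_{li}A_{jk}(λ_{ik}θᵢθ_k + λ_{jl}θⱼθ_l)
− A_lA_{li}²A_iθ_lθᵢ − A_{ij}A_{jk}²A_{kl}A_{li}²(A_iA_jA_kA_l − λ_{ik}λ_{jl})`
(2 distinct equations). -/
def f5 (s : Fin 4) (d : Bool) : R18 :=
  let i := dih s d 0; let j := dih s d 1; let k := dih s d 2; let l := dih s d 3
  thpp i j * thpp k l - aS j * aPP j k ^ 2 * aS k * th j * th k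
    - aPP l i * aPP j k * (lam i * th i * th k + lam j * th j * th l)
    - aS l * aPP l i ^ 2 * aS i * th l * th i
    - aPP i j * aPP j k ^ 2 * aPP k l * aPP l i ^ 2
        * (aS i * aS j * aS k * aS l - lam i * lam j)

/-- All the generators of the G₂ cluster ideal, indexed by the family (`Fin 5`) and the
dihedral permutation (`Fin 4 × Bool`).  As permutations in the same dihedral orbit of an
equation give the same polynomial, the set of values of this family consists of the twenty
defining polynomials (4 + 4 + 8 + 2 + 2). -/
def genG2 : Fin 5 → Fin 4 → Bool → R18 := ![f1, f2, f3, f4, f5]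

/-- The G₂ cluster ideal, generated by the twenty relations. -/
def IG2 : Ideal R18 :=
  Ideal.span (Set.range (fun x : Fin 5 × Fin 4 × Bool => genG2 x.1 x.2.1 x.2.2))

/-- The G₂ cluster variety `X_{G₂} ⊆ ℂ¹⁸`: the common zero locus of the twenty generators. -/
def XG2 : Set (Fin 18 → ℂ) :=
  {p | ∀ (m : Fin 5) (s : Fin 4) (d : Bool), eval p (genG2 m s d) = 0}

/-- The eight cluster variables θ₁, θ₁₂, θ₂, θ₂₃, θ₃, θ₃₄, θ₄, θ₄₁. -/
def clusterVar : Fin 8 → R18 := ![X 0, X 1, X 2, X 3, X 4, X 5, X 6, X 7]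

end

/-- Integral extensions preserve the Krull dimension. -/
theorem ringKrullDim_eq_of_isIntegral_of_injective {R S : Type*} [CommRing R] [CommRing S]
    [Algebra R S] [Algebra.IsIntegral R S] (h : Function.Injective (algebraMap R S)) :
    ringKrullDim S = ringKrullDim R := by
  refine le_antisymm ?_ ?_
  · exact Order.krullDim_le_of_strictMono (PrimeSpectrum.comap (algebraMap R S))
      fun p q hpq => Ideal.IsIntegral.comap_lt_comap (I := p.asIdeal) (J := q.asIdeal) hpq
  · have : Algebra.HasGoingUp R S := ⟨fun {q} _ P _ hP => by
      obtain ⟨Q, hPQ, hQ, hQq⟩ := Ideal.exists_ideal_over_prime_of_isIntegral q P hP.le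
      exact ⟨Q, hPQ, hQ, ⟨hQq.symm⟩⟩⟩
    have : FaithfulSMul R S := (faithfulSMul_iff_algebraMap_injective R S).mpr h
    refine iSup_le fun l => ?_
    obtain ⟨⟨P, hP, hPl⟩⟩ := Ideal.nonempty_primesOver (S := S) l.head.asIdeal
    obtain ⟨L, hL, -⟩ := Ideal.exists_ltSeries_of_hasGoingUp l P
    exact hL ▸ Order.LTSeries.length_le_krullDim L

/-! ### The grading -/

/-- Positive weights for which the generators of `IG2` are homogeneous. -/
def wtG2 : Fin 18 → ℕ := ![3, 5, 3, 5, 3, 5, 3, 5, 1, 1, 1, 1, 1, 1, 1, 1, 2, 2]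

lemma th_homog (i : Fin 4) : IsWeightedHomogeneous wtG2 (th i) 3 := by
  fin_cases i <;> exact isWeightedHomogeneous_X ℂ wtG2 _

lemma thp_homog (i : Fin 4) : IsWeightedHomogeneous wtG2 (thp i) 5 := by
  fin_cases i <;> exact isWeightedHomogeneous_X ℂ wtG2 _

lemma thpp_homog (i j : Fin 4) : IsWeightedHomogeneous wtG2 (thpp i j) 5 := by
  unfold thpp; split_ifs <;> exact thp_homog _

lemma aS_homog (i : Fin 4) : IsWeightedHomogeneous wtG2 (aS i) 1 := by
  fin_cases i <;> exact isWeightedHomogeneous_X ℂ wtG2 _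

lemma aP_homog (i : Fin 4) : IsWeightedHomogeneous wtG2 (aP i) 1 := by
  fin_cases i <;> exact isWeightedHomogeneous_X ℂ wtG2 _

lemma aPP_homog (i j : Fin 4) : IsWeightedHomogeneous wtG2 (aPP i j) 1 := by
  unfold aPP; split_ifs <;> exact aP_homog _

lemma lam_homog (i : Fin 4) : IsWeightedHomogeneous wtG2 (lam i) 2 := by
  fin_cases i <;> exact isWeightedHomogeneous_X ℂ wtG2 _

lemma f1_homog (s : Fin 4) (d : Bool) : IsWeightedHomogeneous wtG2 (f1 s d) 6 :=
  (((th_homog _).mul (th_homog _)).sub ((aPP_homog _ _).mul (thpp_homog _ _))).sub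
    (((((aPP_homog _ _).mul (aS_homog _)).mul ((aPP_homog _ _).pow 2)).mul (aS_homog _)).mul
      (aPP_homog _ _))

lemma f2_homog (s : Fin 4) (d : Bool) : IsWeightedHomogeneous wtG2 (f2 s d) 10 :=
  (((((thpp_homog _ _).mul (thpp_homog _ _)).sub ((aS_homog _).mul ((th_homog _).pow 3))).sub
    ((((lam_homog _).mul (aPP_homog _ _)).mul (aPP_homog _ _)).mul ((th_homog _).pow 2))).sub
    (((((lam_homog _).mul ((aPP_homog _ _).pow 2)).mul (aS_homog _)).mul
      ((aPP_homog _ _).pow 2)).mul (th_homog _))).sub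
    (((((aS_homog _).mul ((aPP_homog _ _).pow 3)).mul ((aS_homog _).pow 2)).mul
      ((aPP_homog _ _).pow 3)).mul (aS_homog _))

lemma f4_homog (s : Fin 4) (d : Bool) : IsWeightedHomogeneous wtG2 (f4 s d) 6 :=
  ((((th_homog _).mul (th_homog _)).sub
    ((((aPP_homog _ _).mul (aS_homog _)).mul (aPP_homog _ _)).mul (th_homog _))).sub
    (((((lam_homog _).mul (aPP_homog _ _)).mul (aPP_homog _ _)).mul (aPP_homog _ _)).mul
      (aPP_homog _ _))).sub
    ((((aPP_homog _ _).mul (aS_homog _)).mul (aPP_homog _ _)).mul (th_homog _))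

lemma f5_homog (s : Fin 4) (d : Bool) : IsWeightedHomogeneous wtG2 (f5 s d) 10 :=
  (((((thpp_homog _ _).mul (thpp_homog _ _)).sub
    (((((aS_homog _).mul ((aPP_homog _ _).pow 2)).mul (aS_homog _)).mul (th_homog _)).mul
      (th_homog _))).sub
    (((aPP_homog _ _).mul (aPP_homog _ _)).mul
      ((((lam_homog _).mul (th_homog _)).mul (th_homog _)).add
        (((lam_homog _).mul (th_homog _)).mul (th_homog _))))).sub
    (((((aS_homog _).mul ((aPP_homog _ _).pow 2)).mul (aS_homog _)).mul (th_homog _)).mul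
      (th_homog _))).sub
    (((((aPP_homog _ _).mul ((aPP_homog _ _).pow 2)).mul (aPP_homog _ _)).mul
      ((aPP_homog _ _).pow 2)).mul
      (((((aS_homog _).mul (aS_homog _)).mul (aS_homog _)).mul (aS_homog _)).sub
        ((lam_homog _).mul (lam_homog _))))

/-- The ideal generated by the coefficients and the parameters. -/
noncomputable def coeffIdeal : Ideal R18 := Ideal.span (X '' {i : Fin 18 | 8 ≤ i})

lemma X_mem_coeffIdeal {i : Fin 18} (hi : 8 ≤ i) : (X i : R18) ∈ coeffIdeal :=
  Ideal.subset_span ⟨i, hi, rfl⟩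

lemma aS_mem (i : Fin 4) : aS i ∈ coeffIdeal := by
  fin_cases i <;> exact X_mem_coeffIdeal (by decide)

lemma aPP_mem (i j : Fin 4) : aPP i j ∈ coeffIdeal := by
  have h (k : Fin 4) : aP k ∈ coeffIdeal := by
    fin_cases k <;> exact X_mem_coeffIdeal (by decide)
  unfold aPP; split_ifs <;> exact h _

lemma genG2_mem (m : Fin 5) (s : Fin 4) (d : Bool) : genG2 m s d ∈ IG2 :=
  Ideal.subset_span ⟨(m, s, d), rfl⟩

/-- `p` is congruent modulo `IG2` to a homogeneous element of `coeffIdeal` of degree `n`. -/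
def Reduces (n : ℕ) (p : R18) : Prop :=
  ∃ r ∈ coeffIdeal, IsWeightedHomogeneous wtG2 r n ∧ p - r ∈ IG2

lemma Reduces.mul {m n k : ℕ} {p q : R18} (hp : Reduces m p)
    (hq : IsWeightedHomogeneous wtG2 q n) (h : m + n = k) : Reduces k (p * q) := by
  obtain ⟨r, hr, hr', hpr⟩ := hp
  exact ⟨r * q, Ideal.mul_mem_right _ _ hr, h ▸ hr'.mul hq,
    by rw [← sub_mul]; exact Ideal.mul_mem_right _ _ hpr⟩

lemma reduces_th_mul_th_succ (s : Fin 4) : Reduces 6 (th s * th (s + 1)) := by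
  refine ⟨th s * th (s + 1) - f1 s true, ?_,
    ((th_homog _).mul (th_homog _)).sub (f1_homog _ _), by
      rw [sub_sub_cancel]; exact genG2_mem 0 s true⟩
  have : th s * th (s + 1) - f1 s true = aPP s (s + 1) * thpp s (s + 1)
      + aS (s + 2) * (aPP (s + 1) (s + 2) * aPP (s + 2) (s + 3) ^ 2 * aS (s + 3)
        * aPP (s + 3) s) := by
    simp [f1, dih]; ring
  rw [this]
  exact add_mem (Ideal.mul_mem_right _ _ (aPP_mem _ _)) (Ideal.mul_mem_right _ _ (aS_mem _))

lemma reduces_th_mul_th_add_two (s : Fin 4) : Reduces 6 (th s * th (s + 2)) := by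
  refine ⟨th s * th (s + 2) - f4 s true, ?_,
    ((th_homog _).mul (th_homog _)).sub (f4_homog _ _), by
      rw [sub_sub_cancel]; exact genG2_mem 3 s true⟩
  have : th s * th (s + 2) - f4 s true = aPP s (s + 1) * (aS (s + 1) * aPP (s + 1) (s + 2)
      * th (s + 1) + lam (s + 1) * aPP (s + 1) (s + 2) * aPP (s + 2) (s + 3) * aPP (s + 3) s)
      + aS (s + 3) * (aPP (s + 2) (s + 3) * aPP (s + 3) s * th (s + 3)) := by
    simp [f4, dih]; ring
  rw [this]
  exact add_mem (Ideal.mul_mem_right _ _ (aPP_mem _ _)) (Ideal.mul_mem_right _ _ (aS_mem _))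

lemma thpp_succ (s : Fin 4) : thpp s (s + 1) = thp s := by simp [thpp]

lemma reduces_thp_mul_thp_succ (s : Fin 4) : Reduces 10 (thp s * thp (s + 1)) := by
  have h2 : thpp (s + 1) (s + 2) = thp (s + 1) := by
    rw [← thpp_succ (s + 1), add_assoc]; rfl
  refine ⟨thp s * thp (s + 1) - f2 s true, ?_,
    ((thp_homog _).mul (thp_homog _)).sub (f2_homog _ _), by
      rw [sub_sub_cancel]; exact genG2_mem 1 s true⟩
  have : thp s * thp (s + 1) - f2 s true = aS (s + 1) * th (s + 1) ^ 3
      + aPP (s + 2) (s + 3) * (lam (s + 1) * aPP (s + 3) s * th (s + 1) ^ 2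
        + lam s * aPP (s + 2) (s + 3) * aS (s + 3) * aPP (s + 3) s ^ 2 * th (s + 1)
        + aS (s + 2) * aPP (s + 2) (s + 3) ^ 2 * aS (s + 3) ^ 2 * aPP (s + 3) s ^ 3 * aS s) := by
    simp [f2, dih, thpp_succ, h2]; ring
  rw [this]
  exact add_mem (Ideal.mul_mem_right _ _ (aS_mem _)) (Ideal.mul_mem_right _ _ (aPP_mem _ _))

lemma reduces_thp_mul_thp_add_two (s : Fin 4) : Reduces 10 (thp s * thp (s + 2)) := by
  have h2 : thpp (s + 2) (s + 3) = thp (s + 2) := by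
    rw [← thpp_succ (s + 2), add_assoc]; rfl
  refine ⟨thp s * thp (s + 2) - f5 s true, ?_,
    ((thp_homog _).mul (thp_homog _)).sub (f5_homog _ _), by
      rw [sub_sub_cancel]; exact genG2_mem 4 s true⟩
  have : thp s * thp (s + 2) - f5 s true =
      aPP (s + 1) (s + 2) * (aS (s + 1) * aPP (s + 1) (s + 2) * aS (s + 2) * th (s + 1)
          * th (s + 2)
        + aPP (s + 3) s * (lam s * th s * th (s + 2) + lam (s + 1) * th (s + 1) * th (s + 3))
        + aPP s (s + 1) * aPP (s + 1) (s + 2) * aPP (s + 2) (s + 3) * aPP (s + 3) s ^ 2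
          * (aS s * aS (s + 1) * aS (s + 2) * aS (s + 3) - lam s * lam (s + 1)))
      + aS (s + 3) * (aPP (s + 3) s ^ 2 * aS s * th (s + 3) * th s) := by
    simp [f5, dih, thpp_succ, h2]; ring
  rw [this]
  exact add_mem (Ideal.mul_mem_right _ _ (aPP_mem _ _)) (Ideal.mul_mem_right _ _ (aS_mem _))

lemma fin_four_cases_of_ne {i j : Fin 4} (h : i ≠ j) : j = i + 1 ∨ j = i + 2 ∨ i = j + 1 := by
  revert i j; decide

lemma reduces_th_mul_th {i j : Fin 4} (h : i ≠ j) : Reduces 6 (th i * th j) := by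
  obtain rfl | rfl | rfl := fin_four_cases_of_ne h
  · exact reduces_th_mul_th_succ _
  · exact reduces_th_mul_th_add_two _
  · rw [mul_comm]; exact reduces_th_mul_th_succ _

lemma reduces_thp_mul_thp {i j : Fin 4} (h : i ≠ j) : Reduces 10 (thp i * thp j) := by
  obtain rfl | rfl | rfl := fin_four_cases_of_ne h
  · exact reduces_thp_mul_thp_succ _
  · exact reduces_thp_mul_thp_add_two _
  · rw [mul_comm]; exact reduces_thp_mul_thp_succ _

/-! ### Finiteness over a polynomial ring in twelve variables -/

/-- A homogeneous system of parameters of `R18 ⧸ IG2`: the sums `∑ θᵢ` and `∑ θ_{i,i+1}`, the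
coefficients and the parameters. -/
noncomputable def sopG2 : Fin 12 → R18 :=
  ![∑ i, th i, ∑ i, thp i, X 8, X 9, X 10, X 11, X 12, X 13, X 14, X 15, X 16, X 17]

/-- The map `ℂ[x₁, …, x₁₂] → R18 ⧸ IG2` given by the system of parameters. -/
noncomputable def sopMap : MvPolynomial (Fin 12) ℂ →ₐ[ℂ] R18 ⧸ IG2 :=
  aeval fun i => Ideal.Quotient.mkₐ ℂ IG2 (sopG2 i)

section Span

variable {S : Type*} [CommRing S] [Algebra S (R18 ⧸ IG2)] {N : Submodule S (R18 ⧸ IG2)} {n : ℕ}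

local notation "π" => Ideal.Quotient.mk IG2

lemma mk_mul_mem {c : S} {a p : R18} (hc : algebraMap S (R18 ⧸ IG2) c = π a) (hp : π p ∈ N) :
    π (a * p) ∈ N := by
  rw [map_mul, ← hc, ← Algebra.smul_def]
  exact N.smul_mem c hp

lemma Reduces.mk_mem (hC : ∀ z : ℂ, ∃ c, algebraMap S (R18 ⧸ IG2) c = π (C z))
    (hX : ∀ i : Fin 18, 8 ≤ i → ∃ c, algebraMap S (R18 ⧸ IG2) c = π (X i))
    (ih : ∀ k < n, ∀ p : R18, IsWeightedHomogeneous wtG2 p k → π p ∈ N)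
    {p : R18} (hp : Reduces n p) : π p ∈ N := by
  obtain ⟨r, hr, hr', hpr⟩ := hp
  rw [Ideal.Quotient.mk_eq_mk_iff_sub_mem _ _ |>.mpr hpr, r.as_sum, map_sum]
  refine N.sum_mem fun d hd => ?_
  obtain ⟨i, hi, hdi⟩ := (mem_ideal_span_X_image.mp hr) d hd
  obtain ⟨c, hc⟩ := hC (coeff d r)
  obtain ⟨c', hc'⟩ := hX i hi
  have hd' : Finsupp.single i 1 + (d - Finsupp.single i 1) = d :=
    add_tsub_cancel_of_le (by simpa [Nat.one_le_iff_ne_zero] using hdi)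
  have hw : wtG2 i + Finsupp.weight wtG2 (d - Finsupp.single i 1) = n := by
    rw [← hr' (mem_support_iff.mp hd), ← hd', map_add]; simp [Finsupp.weight_single]
  have hpos : 0 < wtG2 i := (by decide : ∀ i, 0 < wtG2 i) i
  rw [show monomial d (coeff d r) = C (coeff d r) * (X i * monomial (d - Finsupp.single i 1) 1) by
    rw [X, monomial_mul, hd', C_mul_monomial]; simp]
  exact mk_mul_mem hc (mk_mul_mem hc'
    (ih _ (by lia) _ (isWeightedHomogeneous_monomial _ _ _ rfl)))

lemma mk_sq_mul_mem (hC : ∀ z : ℂ, ∃ c, algebraMap S (R18 ⧸ IG2) c = π (C z))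
    (hX : ∀ i : Fin 18, 8 ≤ i → ∃ c, algebraMap S (R18 ⧸ IG2) c = π (X i))
    (ih : ∀ k < n, ∀ p : R18, IsWeightedHomogeneous wtG2 p k → π p ∈ N)
    {v : Fin 4 → R18} {w : ℕ} (hw : 0 < w) (hv : ∀ i, IsWeightedHomogeneous wtG2 (v i) w)
    (hred : ∀ i j, i ≠ j → Reduces (w + w) (v i * v j))
    (hsum : ∃ c, algebraMap S (R18 ⧸ IG2) c = π (∑ i, v i)) (i : Fin 4)
    {p : R18} {k : ℕ} (hp : IsWeightedHomogeneous wtG2 p k) (hk : w + w + k = n) :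
    π (v i * v i * p) ∈ N := by
  obtain ⟨c, hc⟩ := hsum
  have : v i * v i * p = (∑ j, v j) * (v i * p) - ∑ j ∈ Finset.univ.erase i, v i * v j * p := by
    rw [← Finset.add_sum_erase _ _ (Finset.mem_univ i), add_mul, Finset.sum_mul,
      add_sub_assoc, ← Finset.sum_sub_distrib, Finset.sum_eq_zero fun j _ => by ring]
    ring
  rw [this, map_sub, map_sum]
  refine N.sub_mem (mk_mul_mem hc (ih (w + k) (by lia) _ ((hv i).mul hp)))
    (N.sum_mem fun j hj => Reduces.mk_mem hC hX ih ?_)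
  exact (hred i j (Finset.ne_of_mem_erase hj).symm).mul hp hk

lemma exists_eq_th_or_thp {i : Fin 18} (hi : ¬ 8 ≤ i) :
    (∃ j, (X i : R18) = th j ∧ wtG2 i = 3) ∨ ∃ j, (X i : R18) = thp j ∧ wtG2 i = 5 := by
  fin_cases i
  · exact .inl ⟨0, rfl, rfl⟩
  · exact .inr ⟨0, rfl, rfl⟩
  · exact .inl ⟨1, rfl, rfl⟩
  · exact .inr ⟨1, rfl, rfl⟩
  · exact .inl ⟨2, rfl, rfl⟩
  · exact .inr ⟨2, rfl, rfl⟩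
  · exact .inl ⟨3, rfl, rfl⟩
  · exact .inr ⟨3, rfl, rfl⟩
  all_goals exact absurd (by decide) hi

lemma mk_mem_of_isWeightedHomogeneous
    (hC : ∀ z : ℂ, ∃ c, algebraMap S (R18 ⧸ IG2) c = π (C z))
    (hX : ∀ i : Fin 18, 8 ≤ i → ∃ c, algebraMap S (R18 ⧸ IG2) c = π (X i))
    (hth : ∃ c, algebraMap S (R18 ⧸ IG2) c = π (∑ i, th i))
    (hthp : ∃ c, algebraMap S (R18 ⧸ IG2) c = π (∑ i, thp i))
    (hN : ∀ d : Fin 18 →₀ ℕ, (∀ i, d i ≤ 1) → π (monomial d 1) ∈ N)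
    (n : ℕ) (p : R18) (hp : IsWeightedHomogeneous wtG2 p n) : π p ∈ N := by
  induction n using Nat.strong_induction_on generalizing p with
  | _ n ih =>
    rw [p.as_sum, map_sum]
    refine N.sum_mem fun d hd => ?_
    obtain ⟨c, hc⟩ := hC (coeff d p)
    rw [show monomial d (coeff d p) = C (coeff d p) * monomial d 1 by simp [C_mul_monomial]]
    refine mk_mul_mem hc ?_
    have hdn := hp (mem_support_iff.mp hd)
    by_cases hd1 : ∀ i, d i ≤ 1
    · exact hN d hd1
    push Not at hd1
    obtain ⟨i, hi⟩ := hd1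
    obtain ⟨e, rfl⟩ : ∃ e, d = Finsupp.single i 1 + Finsupp.single i 1 + e :=
      ⟨_, (add_tsub_cancel_of_le (by rw [← Finsupp.single_add]; simpa [Nat.succ_le_iff] using hi)).symm⟩
    have hmon : (monomial (Finsupp.single i 1 + Finsupp.single i 1 + e) 1 : R18)
        = X i * X i * monomial e 1 := by simp [X, monomial_mul]
    have hw : wtG2 i + wtG2 i + Finsupp.weight wtG2 e = n := by
      rw [← hdn, map_add, map_add]; simp [Finsupp.weight_single]
    have he := isWeightedHomogeneous_monomial wtG2 e (1 : ℂ) rfl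
    rw [hmon]
    by_cases h8 : 8 ≤ i
    · have hX' := isWeightedHomogeneous_X ℂ wtG2 i
      refine Reduces.mk_mem hC hX ih ⟨_, ?_, hw ▸ (hX'.mul hX').mul he, by simp⟩
      exact Ideal.mul_mem_right _ _ (Ideal.mul_mem_right _ _ (X_mem_coeffIdeal h8))
    · obtain ⟨j, hj, hj'⟩ | ⟨j, hj, hj'⟩ := exists_eq_th_or_thp h8
      · rw [hj]
        exact mk_sq_mul_mem hC hX ih (by simp) th_homog (fun _ _ => reduces_th_mul_th) hth j he
          (by rw [← hw, hj'])
      · rw [hj]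
        exact mk_sq_mul_mem hC hX ih (by simp) thp_homog (fun _ _ => reduces_thp_mul_thp) hthp j he
          (by rw [← hw, hj'])

theorem isIntegral_quotient_IG2
    (hC : ∀ z : ℂ, ∃ c, algebraMap S (R18 ⧸ IG2) c = π (C z))
    (hX : ∀ i : Fin 18, 8 ≤ i → ∃ c, algebraMap S (R18 ⧸ IG2) c = π (X i))
    (hth : ∃ c, algebraMap S (R18 ⧸ IG2) c = π (∑ i, th i))
    (hthp : ∃ c, algebraMap S (R18 ⧸ IG2) c = π (∑ i, thp i)) :
    Algebra.IsIntegral S (R18 ⧸ IG2) := by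
  let B : Set (Fin 18 →₀ ℕ) := {d | ∀ i, d i ≤ 1}
  have hB : B.Finite := (Set.finite_Iic (Finsupp.equivFunOnFinite.symm 1)).subset
    fun d hd => Finsupp.le_def.mpr hd
  let N : Submodule S (R18 ⧸ IG2) := Submodule.span S ((fun d => π (monomial d 1)) '' B)
  have hN : N = ⊤ := by
    refine eq_top_iff.mpr fun x _ => ?_
    obtain ⟨p, rfl⟩ := Ideal.Quotient.mk_surjective x
    rw [p.as_sum, map_sum]
    have hBN (d : Fin 18 →₀ ℕ) (hd : ∀ i, d i ≤ 1) : π (monomial d 1) ∈ N :=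
      Submodule.subset_span (Set.mem_image_of_mem (fun d => π (monomial d 1)) hd)
    exact N.sum_mem fun d _ => mk_mem_of_isWeightedHomogeneous hC hX hth hthp hBN
      (Finsupp.weight wtG2 d) _ (isWeightedHomogeneous_monomial wtG2 d _ rfl)
  have : Module.Finite S (R18 ⧸ IG2) := Module.finite_def.mpr (hN ▸ Submodule.fg_span (hB.image _))
  infer_instance

end Span

theorem sopMap_isIntegral : sopMap.toRingHom.IsIntegral := by
  let _ : Algebra (MvPolynomial (Fin 12) ℂ) (R18 ⧸ IG2) := sopMap.toRingHom.toAlgebra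
  have hsop (i : Fin 12) : algebraMap (MvPolynomial (Fin 12) ℂ) (R18 ⧸ IG2) (X i)
      = Ideal.Quotient.mk IG2 (sopG2 i) := aeval_X _ i
  have hX (i : Fin 18) (hi : 8 ≤ i) : ∃ c, algebraMap (MvPolynomial (Fin 12) ℂ) (R18 ⧸ IG2) c
      = Ideal.Quotient.mk IG2 (X i) := by
    obtain ⟨j, rfl⟩ : ∃ j : Fin 10, i = Fin.natAdd 8 j :=
      (by decide : ∀ i : Fin 18, 8 ≤ i → ∃ j : Fin 10, i = Fin.natAdd 8 j) i hi
    refine ⟨X (Fin.natAdd 2 j), (hsop _).trans ?_⟩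
    fin_cases j <;> rfl
  exact (isIntegral_quotient_IG2 (fun z => ⟨C z, sopMap.commutes z⟩) hX ⟨X 0, hsop 0⟩
    ⟨X 1, hsop 1⟩).isIntegral

/-! ### The generic point -/

/-- The function field of the cluster variety. -/
abbrev K12 : Type := FractionRing (MvPolynomial (Fin 12) ℂ)

/-- The indeterminates in the function field, in the order
`θ₁, θ₁₂, A₁, A₁₂, A₂, A₂₃, A₃, A₃₄, A₄, A₄₁, λ₁₃, λ₂₄`. -/
noncomputable def gvar (i : Fin 12) : K12 := algebraMap (MvPolynomial (Fin 12) ℂ) K12 (X i)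

section Point

variable {K : Type*} [Field K]

/-- The point of the cluster variety with prescribed values of `θ₁, θ₁₂`, the coefficients and the
parameters (in the order of `gvar`). -/
noncomputable def seedPoint (x : Fin 12 → K) : Fin 18 → K :=
  let t1 := x 0; let t12 := x 1
  let a1 := x 2; let a12 := x 3; let a2 := x 4; let a23 := x 5
  let a3 := x 6; let a34 := x 7; let a4 := x 8; let a41 := x 9
  let m := x 10; let n := x 11
  let t2 := (a12 * t12 + a23 * a3 * a34 ^ 2 * a4 * a41) / t1
  let t41 := (a1 * t1 ^ 3 + m * a23 * a34 * t1 ^ 2 + n * a23 ^ 2 * a3 * a34 ^ 2 * t1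
    + a2 * a23 ^ 3 * a3 ^ 2 * a34 ^ 3 * a4) / t12
  let t4 := (a41 * t41 + a12 * a2 * a23 ^ 2 * a3 * a34) / t1
  let t3 := (a12 * a2 * a23 * t2 + n * a12 * a23 * a34 * a41 + a34 * a4 * a41 * t4) / t1
  let t23 := (a2 * t2 ^ 3 + n * a34 * a41 * t2 ^ 2 + m * a34 ^ 2 * a4 * a41 ^ 2 * t2
    + a3 * a34 ^ 3 * a4 ^ 2 * a41 ^ 3 * a1) / t12
  let t34 := (a41 * a4 * t4 ^ 2 + n * a23 * a12 * a41 * t4 + m * a23 ^ 2 * a2 * a12 ^ 2 * a41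
    + a3 * a23 ^ 2 * a2 * a12 * t3) / t1
  ![t1, t12, t2, t23, t3, t34, t4, t41, a1, a12, a2, a23, a3, a34, a4, a41, m, n]

set_option maxHeartbeats 4000000 in
theorem aeval_seedPoint_genG2 [Algebra ℂ K] {x : Fin 12 → K} (h0 : x 0 ≠ 0) (h1 : x 1 ≠ 0)
    (m : Fin 5) (s : Fin 4) (d : Bool) : aeval (seedPoint x) (genG2 m s d) = 0 := by
  have e1 : (-1 : Fin 4) = 3 := rfl
  have e2 : (-2 : Fin 4) = 2 := rfl
  have e3 : (-3 : Fin 4) = 1 := rfl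
  fin_cases m <;> fin_cases s <;> cases d <;>
  · simp [genG2, f1, f2, f3, f4, f5, dih, th, thpp, thp, aS, aPP, aP, lam, e1, e2, e3]
    simp [seedPoint]
    field_simp
    ring

end Point

/-- An integral map from a polynomial ring in `n` variables is injective if its target has a
quotient domain of transcendence degree at least `n`. -/
theorem MvPolynomial.injective_of_isIntegral_of_algebraicIndependent {ι k A D : Type}
    [Finite ι] [Field k] [CommRing A] [Algebra k A] [CommRing D] [IsDomain D] [Algebra k D]
    {f : MvPolynomial ι k →ₐ[k] A} (hf : f.toRingHom.IsIntegral) (g : A →ₐ[k] D)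
    {z : ι → A} (hz : AlgebraicIndependent k (g ∘ z)) : Function.Injective f := by
  let x : ι → g.range := fun i => g.rangeRestrict (f (X i))
  have hx : aeval x = g.rangeRestrict.comp f := by ext i; simp [x]
  have hint : Algebra.IsIntegral (Algebra.adjoin k (Set.range x)) g.range := by
    refine ⟨fun b => ?_⟩
    obtain ⟨a, rfl⟩ := g.rangeRestrict_surjective b
    obtain ⟨p, hp, hpa⟩ := hf a
    let h : MvPolynomial ι k →ₐ[k] Algebra.adjoin k (Set.range x) :=
      aeval fun i => ⟨x i, Algebra.subset_adjoin ⟨i, rfl⟩⟩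
    refine ⟨p.map h.toRingHom, hp.map _, ?_⟩
    have hcomp : (algebraMap (Algebra.adjoin k (Set.range x)) g.range).comp h.toRingHom
        = (g.rangeRestrict : A →+* g.range).comp f.toRingHom := by
      have : (Algebra.adjoin k (Set.range x)).val.comp h = g.rangeRestrict.comp f := by
        ext i; simp [h, x]
      exact congrArg AlgHom.toRingHom this
    rw [Polynomial.eval₂_map, hcomp, ← map_zero (g.rangeRestrict : A →+* g.range), ← hpa,
      Polynomial.hom_eval₂]
    rfl
  have hle : Cardinal.mk ι ≤ Algebra.trdeg k g.range :=
    AlgebraicIndependent.cardinalMk_le_trdeg (x := fun i => g.rangeRestrict (z i))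
      (.of_comp g.range.val hz)
  have hind := (Algebra.IsAlgebraic.isTranscendenceBasis_of_le_trdeg_of_finite k x hle).1
  rw [AlgebraicIndependent, hx, AlgHom.coe_comp] at hind
  exact .of_comp hind

theorem gvar_ne_zero (i : Fin 12) : gvar i ≠ 0 :=
  (map_ne_zero_iff _ (IsFractionRing.injective _ K12)).mpr (X_ne_zero i)

theorem algebraicIndependent_gvar : AlgebraicIndependent ℂ gvar :=
  (MvPolynomial.algebraicIndependent_X (Fin 12) ℂ).map'
    (f := IsScalarTower.toAlgHom ℂ (MvPolynomial (Fin 12) ℂ) K12) (IsFractionRing.injective _ K12)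

theorem IG2_le_ker_aeval_seedPoint :
    IG2 ≤ RingHom.ker (aeval (seedPoint gvar) : R18 →ₐ[ℂ] K12) := by
  refine Ideal.span_le.mpr ?_
  rintro _ ⟨⟨m, s, d⟩, rfl⟩
  exact aeval_seedPoint_genG2 (gvar_ne_zero 0) (gvar_ne_zero 1) m s d

theorem sopMap_injective : Function.Injective sopMap := by
  let z (i : Fin 12) : R18 ⧸ IG2 :=
    Ideal.Quotient.mk IG2 (X (![0, 1, 8, 9, 10, 11, 12, 13, 14, 15, 16, 17] i))
  let g := Ideal.Quotient.liftₐ IG2 (aeval (seedPoint gvar)) IG2_le_ker_aeval_seedPoint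
  have hgz : g ∘ z = gvar := by
    ext i
    change aeval (seedPoint gvar) (X _) = _
    rw [aeval_X]
    fin_cases i <;> rfl
  exact MvPolynomial.injective_of_isIntegral_of_algebraicIndependent sopMap_isIntegral g
    (hgz ▸ algebraicIndependent_gvar)


/-- The quotient ring `R18 ⧸ IG2` has Krull dimension 12; that is, the
G₂ cluster variety is a 12-dimensional affine variety of codimension 6 in ℂ¹⁸. -/
theorem IG2_krullDim : ringKrullDim (R18 ⧸ IG2) = 12 := by
  let _ : Algebra (MvPolynomial (Fin 12) ℂ) (R18 ⧸ IG2) := sopMap.toRingHom.toAlgebra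
  have : Algebra.IsIntegral (MvPolynomial (Fin 12) ℂ) (R18 ⧸ IG2) :=
    algebraMap_isIntegral_iff.mp sopMap_isIntegral
  rw [ringKrullDim_eq_of_isIntegral_of_injective (R := MvPolynomial (Fin 12) ℂ) sopMap_injective,
    MvPolynomial.ringKrullDim_of_isNoetherianRing, ringKrullDim_eq_zero_of_field]
  simp
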